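/- Let α∈ℝ and 0<p,q<∞. Then there is a constant C (depending on α, p, q, n, φ) such that for all f∈𝒮'/𝒫, sup_{Q∈𝒬}(1/|Q|)∫_Q (Σ_{k∈ℤ: 2^{-k}≤ℓ(Q)}(2^{αk}|φ_k*f(x)|)^q)^p dx ≤ C‖f‖_{Ḟ_∞^{α,q}}^{pq}. -/

import Mathlib

open MeasureTheory ENNReal Set SchwartzMap FourierTransform

noncomputable section

namespace JNW

/-- Affine maps have temperate growth. -/
lemma hasTemperateGrowth_affine {E : Type*} [NormedAddCommGroup E] [NormedSpace ℝ E]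
    (c : E) (A : E →L[ℝ] E) : Function.HasTemperateGrowth fun y => c + A y := by
  apply Function.HasTemperateGrowth.of_fderiv (k := 1) (C := ‖c‖ + ‖A‖)
  · have h : (fderiv ℝ fun y : E => c + A y) = fun _ : E => (A : E →L[ℝ] E) := by
      funext y
      rw [fderiv_const_add]
      exact A.fderiv
    rw [h]
    exact Function.HasTemperateGrowth.const _
  · exact A.differentiable.const_add c
  · intro x
    have h1 : ‖c + A x‖ ≤ ‖c‖ + ‖A‖ * ‖x‖ :=
      (norm_add_le _ _).trans (by gcongr; exact A.le_opNorm x)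
    have h2 : (0:ℝ) ≤ ‖A‖ := norm_nonneg _
    have h3 : (0:ℝ) ≤ ‖c‖ := norm_nonneg _
    have h4 : (0:ℝ) ≤ ‖x‖ := norm_nonneg _
    simp only [pow_one]
    nlinarith

/-- The continuous linear map on Schwartz space sending `φ` to `y ↦ φ(c - r y)`,
used to define the convolution of a tempered distribution with `φ` by duality. -/
def dilTransCLM {E : Type*} [NormedAddCommGroup E] [NormedSpace ℝ E]
    (c : E) (r : ℝ) (hr : r ≠ 0) : 𝓢(E, ℂ) →L[ℂ] 𝓢(E, ℂ) :=
  SchwartzMap.compCLM ℂ (hasTemperateGrowth_affine c ((-r) • ContinuousLinearMap.id ℝ E))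
    ⟨1, |r|⁻¹ * (1 + ‖c‖), by
      intro x
      have h4 : (0:ℝ) < |r| := abs_pos.2 hr
      have happ : ((-r) • ContinuousLinearMap.id ℝ E) x = -(r • x) := by
        simp [neg_smul]
      have hx : r • x = c - (c + ((-r) • ContinuousLinearMap.id ℝ E) x) := by
        rw [happ]; abel
      have h2 : ‖r • x‖ ≤ ‖c‖ + ‖c + ((-r) • ContinuousLinearMap.id ℝ E) x‖ := by
        rw [hx]; exact norm_sub_le _ _
      have h3 : ‖r • x‖ = |r| * ‖x‖ := by rw [norm_smul, Real.norm_eq_abs]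
      have key : ‖x‖ = |r|⁻¹ * ‖r • x‖ := by
        rw [h3, ← mul_assoc, inv_mul_cancel₀ h4.ne', one_mul]
      have h5 : (0:ℝ) ≤ ‖c + ((-r) • ContinuousLinearMap.id ℝ E) x‖ := norm_nonneg _
      have h6 : (0:ℝ) ≤ ‖c‖ := norm_nonneg _
      have h7 : (0:ℝ) ≤ |r|⁻¹ := inv_nonneg.2 h4.le
      simp only [pow_one]
      calc ‖x‖ = |r|⁻¹ * ‖r • x‖ := key
        _ ≤ |r|⁻¹ * (‖c‖ + ‖c + ((-r) • ContinuousLinearMap.id ℝ E) x‖) := by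
            exact mul_le_mul_of_nonneg_left h2 h7
        _ ≤ |r|⁻¹ * ((1 + ‖c‖) * (1 + ‖c + ((-r) • ContinuousLinearMap.id ℝ E) x‖)) := by
            have hcg : ‖c‖ + ‖c + ((-r) • ContinuousLinearMap.id ℝ E) x‖ ≤
                (1 + ‖c‖) * (1 + ‖c + ((-r) • ContinuousLinearMap.id ℝ E) x‖) := by nlinarith
            exact mul_le_mul_of_nonneg_left hcg h7
        _ = |r|⁻¹ * (1 + ‖c‖) * (1 + ‖c + ((-r) • ContinuousLinearMap.id ℝ E) x‖) :=
            (mul_assoc _ _ _).symm⟩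

/-- `(φ_k * f)(x)` for a tempered distribution `f`, where `φ_k(y) = 2^{kn} φ(2^k y)`:
by duality, `(φ_k * f)(x) = f(y ↦ φ_k(x - y)) = 2^{kn} f(y ↦ φ(2^k x - 2^k y))`. -/
def convDist (n : ℕ) (φ : 𝓢(EuclideanSpace ℝ (Fin n), ℂ))
    (T : 𝓢(EuclideanSpace ℝ (Fin n), ℂ) →L[ℂ] ℂ) (k : ℤ)
    (x : EuclideanSpace ℝ (Fin n)) : ℂ :=
  (((2:ℝ) ^ (k * (n:ℤ)) : ℝ) : ℂ) *
    T (dilTransCLM ((2:ℝ) ^ k • x) ((2:ℝ) ^ k) (by positivity) φ)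

/-- The axis-parallel cube in `ℝⁿ` with corner `a` and side length `h`. -/
def ecube {n : ℕ} (a : EuclideanSpace ℝ (Fin n)) (h : ℝ) : Set (EuclideanSpace ℝ (Fin n)) :=
  {x | ∀ i, x i ∈ Set.Ioc (a i) (a i + h)}

/-- The inner sum `Σ_{k ∈ ℤ : 2^{-k} ≤ ℓ(Q)} (2^{αk} |φ_k * f(x)|)^q` over a cube of side
length `h`. -/
def tlSum (n : ℕ) (α q : ℝ) (φ : 𝓢(EuclideanSpace ℝ (Fin n), ℂ))
    (T : 𝓢(EuclideanSpace ℝ (Fin n), ℂ) →L[ℂ] ℂ) (h : ℝ)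
    (x : EuclideanSpace ℝ (Fin n)) : ℝ≥0∞ :=
  ∑' k : {k : ℤ // (2:ℝ) ^ (-k) ≤ h},
    (ENNReal.ofReal ((2:ℝ) ^ (α * (k.1 : ℝ))) * (‖convDist n φ T k.1 x‖₊ : ℝ≥0∞)) ^ q

/-- `‖f‖_{Ḟ_∞^{α,q}}`. -/
def tlNorm (n : ℕ) (α q : ℝ) (φ : 𝓢(EuclideanSpace ℝ (Fin n), ℂ))
    (T : 𝓢(EuclideanSpace ℝ (Fin n), ℂ) →L[ℂ] ℂ) : ℝ≥0∞ :=
  (⨆ (a : EuclideanSpace ℝ (Fin n)) (h : ℝ) (_ : 0 < h),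
    (∫⁻ x in ecube a h, tlSum n α q φ T h x) / volume (ecube a h)) ^ (1 / q)

end JNW

namespace JNW

/-- The elementary inequality behind the telescoping of powers of tails. -/
lemma add_pow_succ_le (a t : ℝ≥0∞) (m : ℕ) :
    (a + t) ^ (m + 1) ≤ t ^ (m + 1) + (m + 1) * (a * (a + t) ^ m) := by
  induction m with
  | zero => simp [add_comm]
  | succ m ih =>
    calc (a + t) ^ (m + 1 + 1) = a * (a + t) ^ (m + 1) + t * (a + t) ^ (m + 1) := by
          rw [pow_succ' (a + t) (m + 1), add_mul]
      _ ≤ a * (a + t) ^ (m + 1) + t * (t ^ (m + 1) + (m + 1) * (a * (a + t) ^ m)) := by gcongr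
      _ = t ^ (m + 1 + 1) + (a * (a + t) ^ (m + 1) + (m + 1) * (a * (t * (a + t) ^ m))) := by ring
      _ ≤ t ^ (m + 1 + 1) +
          (a * (a + t) ^ (m + 1) + (m + 1) * (a * ((a + t) * (a + t) ^ m))) := by
          gcongr
          exact le_add_self
      _ = t ^ (m + 1 + 1) + ((m + 1 : ℕ) + 1) * (a * (a + t) ^ (m + 1)) := by
          push_cast; ring

lemma sum_range_pow_succ_le (m N : ℕ) (b : ℕ → ℝ≥0∞) :
    (∑ i ∈ Finset.range N, b i) ^ (m + 1) ≤
      (m + 1) * ∑ i ∈ Finset.range N, b i * (∑' j, b (i + j)) ^ m := by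
  induction N generalizing b with
  | zero => simp
  | succ N ih =>
    have h1 : b 0 + ∑ i ∈ Finset.range N, b (i + 1) ≤ ∑' j, b (0 + j) := by
      rw [add_comm, ← Finset.sum_range_succ']
      simpa using ENNReal.sum_le_tsum (f := b) (Finset.range (N + 1))
    rw [Finset.sum_range_succ', Finset.sum_range_succ', add_comm]
    refine (add_pow_succ_le _ _ m).trans ?_
    rw [mul_add]
    refine add_le_add ((ih fun i => b (i + 1)).trans_eq ?_) (by gcongr)
    simp only [add_right_comm]

/-- A power of a series is controlled by the series of its terms times powers of tails. -/
lemma tsum_pow_succ_le (m : ℕ) (b : ℕ → ℝ≥0∞) :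
    (∑' i, b i) ^ (m + 1) ≤ (m + 1) * ∑' i, b i * (∑' j, b (i + j)) ^ m := by
  have h := (ENNReal.continuous_pow (m + 1)).continuousAt.tendsto.comp
    (ENNReal.tendsto_nat_tsum b)
  refine le_of_tendsto' h fun N => (sum_range_pow_succ_le m N b).trans ?_
  gcongr
  exact ENNReal.sum_le_tsum _

lemma measurableSet_ecube {n : ℕ} (a : EuclideanSpace ℝ (Fin n)) (h : ℝ) :
    MeasurableSet (ecube a h) := by
  have : ecube a h = ⋂ i, (fun x : EuclideanSpace ℝ (Fin n) => x i) ⁻¹' Ioc (a i) (a i + h) := by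
    ext; simp [ecube]
  rw [this]
  exact MeasurableSet.iInter fun i => measurableSet_Ioc.preimage (by fun_prop)

lemma volume_ecube {n : ℕ} (a : EuclideanSpace ℝ (Fin n)) (h : ℝ) :
    volume (ecube a h) = ENNReal.ofReal h ^ n := by
  have : ecube a h = WithLp.ofLp ⁻¹' (Set.pi univ fun i => Ioc (a i) (a i + h)) := by
    ext; simp [ecube]
  rw [this, (PiLp.volume_preserving_ofLp (Fin n)).measure_preimage
    (MeasurableSet.univ_pi fun i => measurableSet_Ioc).nullMeasurableSet, Real.volume_pi_Ioc]
  simp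

/-- The cube centred at `z` with side length `2 * r` contains the ball of radius `r`. -/
lemma ball_subset_ecube {n : ℕ} (z : EuclideanSpace ℝ (Fin n)) (r : ℝ) :
    Metric.ball z r ⊆ ecube (z - WithLp.toLp 2 fun _ => r) (2 * r) := by
  intro y hy i
  have h : |y i - z i| < r := by
    have := (PiLp.norm_apply_le (y - z) i).trans_lt (mem_ball_iff_norm.1 hy)
    simpa using this
  rw [abs_lt] at h
  constructor <;> simp <;> linarith

lemma mem_ecube_of_dist_lt {n : ℕ} {a y z : EuclideanSpace ℝ (Fin n)} {h r : ℝ}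
    (hy : y ∈ ecube a h) (hz : dist y z < r) :
    z ∈ ecube (a - WithLp.toLp 2 fun _ => r) (h + 2 * r) := by
  intro i
  have h1 := ball_subset_ecube y r (by rwa [Metric.mem_ball'] : z ∈ Metric.ball y r) i
  have h2 := hy i
  simp only [PiLp.sub_apply, mem_Ioc] at h1 h2 ⊢
  constructor <;> linarith

lemma ecube_mono {n : ℕ} {a b : EuclideanSpace ℝ (Fin n)} {h k : ℝ}
    (h1 : ∀ i, b i ≤ a i) (h2 : ∀ i, a i + h ≤ b i + k) : ecube a h ⊆ ecube b k :=
  fun _ hx i => ⟨(h1 i).trans_lt (hx i).1, (hx i).2.trans (h2 i)⟩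

/-- One averaging step: if `f` is dominated at `y` by its weighted averages over balls of radii
`2 ^ l / r`, and `g` has bounded averages over cubes larger than `1 / r`, then `∫ f g` over a cube
is controlled by integrals of `f` over dilated cubes. -/
lemma lintegral_mul_le_of_averages {n : ℕ} {f g : EuclideanSpace ℝ (Fin n) → ℝ≥0∞}
    (hf : Measurable f) (hg : Measurable g) {C K : ℝ≥0∞} {r : ℝ} (hr : 0 < r)
    (hfC : ∀ y, f y ≤ C * ∑' l : ℕ, (2⁻¹ : ℝ≥0∞) ^ (l * (2 * n + 1)) *
      (ENNReal.ofReal r ^ n * ∫⁻ z in Metric.ball y (2 ^ l / r), f z))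
    (hgK : ∀ a h, r⁻¹ ≤ h → ∫⁻ y in ecube a h, g y ≤ K * ENNReal.ofReal h ^ n)
    (a : EuclideanSpace ℝ (Fin n)) {h : ℝ} (hh : r⁻¹ ≤ h) :
    ∫⁻ y in ecube a h, f y * g y ≤ C * ∑' l : ℕ, (2⁻¹ : ℝ≥0∞) ^ (l * (n + 1)) * (2 ^ n * K *
      ∫⁻ z in ecube (a - WithLp.toLp 2 fun _ => 2 ^ l * h) (3 * 2 ^ l * h), f z) := by
  have hh0 : 0 < h := (inv_pos.2 hr).trans_le hh
  have key (l : ℕ) : ∫⁻ y in ecube a h, (∫⁻ z in Metric.ball y (2 ^ l / r), f z) * g y ≤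
      K * ENNReal.ofReal (2 * (2 ^ l / r)) ^ n *
        ∫⁻ z in ecube (a - WithLp.toLp 2 fun _ => 2 ^ l * h) (3 * 2 ^ l * h), f z := by
    set s : ℝ := 2 ^ l / r with hs
    have hs0 : 0 < s := by positivity
    have hsr : r⁻¹ ≤ 2 * s := by
      have : (1:ℝ) ≤ 2 ^ l := one_le_pow₀ (by norm_num)
      have h1 : r⁻¹ ≤ s := by
        rw [hs, div_eq_mul_inv]; exact le_mul_of_one_le_left (by positivity) this
      linarith
    have hsh : s ≤ 2 ^ l * h := by
      rw [hs, div_eq_mul_inv]; gcongr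
    have hD : MeasurableSet {p : EuclideanSpace ℝ (Fin n) × EuclideanSpace ℝ (Fin n) |
        dist p.1 p.2 < s} := measurableSet_lt (by fun_prop) measurable_const
    have hF : Measurable (Function.uncurry fun y z : EuclideanSpace ℝ (Fin n) =>
        {p : EuclideanSpace ℝ (Fin n) × EuclideanSpace ℝ (Fin n) | dist p.1 p.2 < s}.indicator
          (fun p => f p.2 * g p.1) (y, z)) :=
      Measurable.indicator (by fun_prop) hD
    calc ∫⁻ y in ecube a h, (∫⁻ z in Metric.ball y s, f z) * g y
        = ∫⁻ y in ecube a h, ∫⁻ z, {p : EuclideanSpace ℝ (Fin n) × EuclideanSpace ℝ (Fin n) |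
            dist p.1 p.2 < s}.indicator (fun p => f p.2 * g p.1) (y, z) := by
          refine lintegral_congr fun y => ?_
          rw [← lintegral_indicator measurableSet_ball, ← lintegral_mul_const _
            (hf.indicator measurableSet_ball)]
          refine lintegral_congr fun z => ?_
          by_cases hz : dist y z < s
          · simp [indicator, dist_comm z y, hz]
          · simp [indicator, dist_comm z y, hz]
      _ = ∫⁻ z, ∫⁻ y in ecube a h, {p : EuclideanSpace ℝ (Fin n) × EuclideanSpace ℝ (Fin n) |
            dist p.1 p.2 < s}.indicator (fun p => f p.2 * g p.1) (y, z) :=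
          lintegral_lintegral_swap hF.aemeasurable
      _ ≤ ∫⁻ z, (ecube (a - WithLp.toLp 2 fun _ => 2 ^ l * h) (3 * 2 ^ l * h)).indicator
            (fun z => K * ENNReal.ofReal (2 * s) ^ n * f z) z := by
          refine lintegral_mono fun z => ?_
          by_cases hz : z ∈ ecube (a - WithLp.toLp 2 fun _ => 2 ^ l * h) (3 * 2 ^ l * h)
          · rw [indicator_of_mem hz]
            calc _ ≤ ∫⁻ y, (ecube (z - WithLp.toLp 2 fun _ => s) (2 * s)).indicator
                    (fun y => f z * g y) y := by
                  refine (setLIntegral_le_lintegral _ _).trans (lintegral_mono fun y => ?_)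
                  by_cases hy : dist y z < s
                  · rw [indicator_of_mem (ball_subset_ecube z s hy)]
                    exact indicator_le_self' (by simp) _
                  · simp [indicator, hy]
              _ = f z * ∫⁻ y in ecube (z - WithLp.toLp 2 fun _ => s) (2 * s), g y := by
                  rw [lintegral_indicator (measurableSet_ecube _ _), lintegral_const_mul _ hg]
              _ ≤ f z * (K * ENNReal.ofReal (2 * s) ^ n) := by
                  gcongr; exact hgK _ _ hsr
              _ = _ := mul_comm _ _
          · rw [indicator_of_notMem hz]
            refine le_of_eq ?_
            rw [← lintegral_zero (μ := volume.restrict (ecube a h))]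
            refine setLIntegral_congr_fun (measurableSet_ecube _ _) fun y hy => ?_
            refine indicator_of_notMem ?_ _
            intro (hyz : dist y z < s)
            refine hz ?_
            have h1 : (1:ℝ) ≤ 2 ^ l := one_le_pow₀ (by norm_num)
            have h2 : h ≤ 2 ^ l * h := le_mul_of_one_le_left hh0.le h1
            refine ecube_mono (fun i => ?_) (fun i => ?_) (mem_ecube_of_dist_lt hy hyz)
            · simp only [PiLp.sub_apply]; linarith
            · simp only [PiLp.sub_apply]; linarith
      _ = _ := by
          rw [lintegral_indicator (measurableSet_ecube _ _), lintegral_const_mul _ hf]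
  calc ∫⁻ y in ecube a h, f y * g y
      ≤ ∫⁻ y in ecube a h, C * ∑' l : ℕ, (2⁻¹ : ℝ≥0∞) ^ (l * (2 * n + 1)) *
          ENNReal.ofReal r ^ n * ((∫⁻ z in Metric.ball y (2 ^ l / r), f z) * g y) := by
        refine lintegral_mono fun y => ?_
        calc f y * g y ≤ _ := mul_le_mul_left (hfC y) (g y)
          _ = _ := by
            rw [mul_assoc, ← ENNReal.tsum_mul_right]
            simp only [mul_assoc]
    _ = C * ∑' l : ℕ, (2⁻¹ : ℝ≥0∞) ^ (l * (2 * n + 1)) * ENNReal.ofReal r ^ n *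
          ∫⁻ y in ecube a h, (∫⁻ z in Metric.ball y (2 ^ l / r), f z) * g y := by
        have hm (l : ℕ) : Measurable fun y : EuclideanSpace ℝ (Fin n) =>
            (∫⁻ z in Metric.ball y (2 ^ l / r), f z) * g y := by
          refine Measurable.mul ?_ hg
          have hD : MeasurableSet {p : EuclideanSpace ℝ (Fin n) × EuclideanSpace ℝ (Fin n) |
            dist p.1 p.2 < 2 ^ l / r} := measurableSet_lt (by fun_prop) measurable_const
          have : Measurable fun p : EuclideanSpace ℝ (Fin n) × EuclideanSpace ℝ (Fin n) =>
            {p : EuclideanSpace ℝ (Fin n) × EuclideanSpace ℝ (Fin n) |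
              dist p.1 p.2 < 2 ^ l / r}.indicator (fun p => f p.2) p :=
            Measurable.indicator (by fun_prop) hD
          convert this.lintegral_prod_right' (ν := volume) using 2 with y
          rw [← lintegral_indicator measurableSet_ball]
          refine lintegral_congr fun z => ?_
          simp [indicator, dist_comm z y]
        rw [lintegral_const_mul _ (Measurable.tsum fun l => (hm l).const_mul _),
          lintegral_tsum fun l => ((hm l).const_mul _).aemeasurable]
        simp_rw [lintegral_const_mul _ (hm _)]
    _ ≤ C * ∑' l : ℕ, (2⁻¹ : ℝ≥0∞) ^ (l * (2 * n + 1)) * ENNReal.ofReal r ^ n *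
          (K * ENNReal.ofReal (2 * (2 ^ l / r)) ^ n *
        ∫⁻ z in ecube (a - WithLp.toLp 2 fun _ => 2 ^ l * h) (3 * 2 ^ l * h), f z) := by
        gcongr with l
        exact key l
    _ = _ := by
        congr 2
        funext l
        have e1 : ENNReal.ofReal r ^ n * ENNReal.ofReal (2 * (2 ^ l / r)) ^ n
            = 2 ^ n * (2 ^ l) ^ n := by
          rw [← mul_pow, ← ENNReal.ofReal_mul hr.le, ← mul_pow]
          congr 1
          have : r * (2 * (2 ^ l / r)) = 2 * 2 ^ l := by field_simp
          rw [this, ENNReal.ofReal_mul (by norm_num), ENNReal.ofReal_pow (by norm_num)]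
          simp
        have e2 : (2⁻¹ : ℝ≥0∞) ^ (l * (2 * n + 1)) * (2 ^ l) ^ n = 2⁻¹ ^ (l * (n + 1)) := by
          have : l * (2 * n + 1) = l * (n + 1) + l * n := by ring
          rw [this, pow_add, ← pow_mul, mul_assoc, ← mul_pow,
            ENNReal.inv_mul_cancel (by simp) (by simp), one_pow, mul_one]
        rw [← e2]
        calc _ = (2⁻¹ : ℝ≥0∞) ^ (l * (2 * n + 1)) * (ENNReal.ofReal r ^ n *
              ENNReal.ofReal (2 * (2 ^ l / r)) ^ n) * (K *
              ∫⁻ z in ecube (a - WithLp.toLp 2 fun _ => 2 ^ l * h) (3 * 2 ^ l * h), f z) := by ring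
          _ = _ := by rw [e1]; ring

/-- A John–Nirenberg inequality: integer moments of the sums `∑_{k ≥ k₀} f k` over cubes of
side length at least `2 ^ (-k₀)`. -/
lemma lintegral_tail_pow_le {n : ℕ} {f : ℤ → EuclideanSpace ℝ (Fin n) → ℝ≥0∞}
    (hf : ∀ k, Measurable (f k)) {B C : ℝ≥0∞}
    (hfC : ∀ k y, f k y ≤ C * ∑' l : ℕ, (2⁻¹ : ℝ≥0∞) ^ (l * (2 * n + 1)) *
      (ENNReal.ofReal (2 ^ k) ^ n * ∫⁻ z in Metric.ball y (2 ^ l / 2 ^ k), f k z))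
    (hfB : ∀ (k₀ : ℤ) a h, ((2:ℝ) ^ k₀)⁻¹ ≤ h →
      ∫⁻ y in ecube a h, ∑' i : ℕ, f (k₀ + i) y ≤ B * ENNReal.ofReal h ^ n)
    (m : ℕ) (k₀ : ℤ) (a : EuclideanSpace ℝ (Fin n)) (h : ℝ) (hh : ((2:ℝ) ^ k₀)⁻¹ ≤ h) :
    ∫⁻ y in ecube a h, (∑' i : ℕ, f (k₀ + i) y) ^ m ≤
      m.factorial * (2 * 6 ^ n * C) ^ m * B ^ m * ENNReal.ofReal h ^ n := by
  induction m generalizing k₀ a h with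
  | zero => simp [volume_ecube]
  | succ m ih =>
    have hS (k : ℤ) : Measurable fun y => ∑' i : ℕ, f (k + i) y :=
      Measurable.tsum fun i => hf _
    set K : ℝ≥0∞ := m.factorial * (2 * 6 ^ n * C) ^ m * B ^ m with hK
    have hh0 : 0 < h := (by positivity : (0:ℝ) < ((2:ℝ) ^ k₀)⁻¹).trans_le hh
    set Q : ℕ → Set (EuclideanSpace ℝ (Fin n)) := fun l =>
      ecube (a - WithLp.toLp 2 fun _ => 2 ^ l * h) (3 * 2 ^ l * h) with hQ
    calc ∫⁻ y in ecube a h, (∑' i : ℕ, f (k₀ + i) y) ^ (m + 1)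
        ≤ ∫⁻ y in ecube a h, (m + 1) *
            ∑' i : ℕ, f (k₀ + i) y * (∑' j : ℕ, f (k₀ + i + j) y) ^ m := by
          refine lintegral_mono fun y => (tsum_pow_succ_le m fun i => f (k₀ + i) y).trans_eq ?_
          simp only [Nat.cast_add, add_assoc]
      _ = (m + 1) * ∑' i : ℕ, ∫⁻ y in ecube a h,
            f (k₀ + i) y * (∑' j : ℕ, f (k₀ + i + j) y) ^ m := by
          have hm (i : ℕ) : Measurable fun y =>
              f (k₀ + i) y * (∑' j : ℕ, f (k₀ + i + j) y) ^ m := (hf _).mul ((hS _).pow_const m)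
          rw [lintegral_const_mul _ (Measurable.tsum hm),
            lintegral_tsum fun i => (hm i).aemeasurable]
      _ ≤ (m + 1) * ∑' i : ℕ, C * ∑' l : ℕ, (2⁻¹ : ℝ≥0∞) ^ (l * (n + 1)) *
            (2 ^ n * K * ∫⁻ z in Q l, f (k₀ + i) z) := by
          gcongr with i
          have h1 : (2:ℝ) ^ k₀ ≤ 2 ^ (k₀ + i) := zpow_le_zpow_right₀ (by norm_num) (by simp)
          refine lintegral_mul_le_of_averages (hf _) ((hS _).pow_const m) (by positivity)
            (hfC _) (fun b s hs => ih _ b s hs) a ((inv_anti₀ (by positivity) h1).trans hh)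
      _ = (m + 1) * (C * ∑' l : ℕ, (2⁻¹ : ℝ≥0∞) ^ (l * (n + 1)) *
            (2 ^ n * K * ∫⁻ z in Q l, ∑' i : ℕ, f (k₀ + i) z)) := by
          simp_rw [lintegral_tsum fun i : ℕ => (hf (k₀ + i)).aemeasurable,
            ENNReal.tsum_mul_left]
          rw [ENNReal.tsum_comm]
          simp_rw [ENNReal.tsum_mul_left]
      _ ≤ (m + 1) * (C * ∑' l : ℕ, (2⁻¹ : ℝ≥0∞) ^ (l * (n + 1)) *
            (2 ^ n * K * (B * ENNReal.ofReal (3 * 2 ^ l * h) ^ n))) := by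
          gcongr with l
          refine hfB _ _ _ (hh.trans ?_)
          have : (1:ℝ) ≤ 2 ^ l := one_le_pow₀ (by norm_num)
          nlinarith
      _ = (m + 1) * (C * ∑' l : ℕ, (2⁻¹ : ℝ≥0∞) ^ l *
            (6 ^ n * K * B * ENNReal.ofReal h ^ n)) := by
          congr 3
          funext l
          have e1 : ENNReal.ofReal (3 * 2 ^ l * h) = 3 * 2 ^ l * ENNReal.ofReal h := by
            rw [ENNReal.ofReal_mul (by positivity), ENNReal.ofReal_mul (by positivity),
              ENNReal.ofReal_pow (by positivity)]
            simp
          have e2 : (2⁻¹ : ℝ≥0∞) ^ (l * (n + 1)) * (2 ^ l) ^ n = 2⁻¹ ^ l := by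
            have : l * (n + 1) = l + l * n := by ring
            rw [this, pow_add, ← pow_mul, mul_assoc, ← mul_pow,
              ENNReal.inv_mul_cancel (by simp) (by simp), one_pow, mul_one]
          have e3 : (6 : ℝ≥0∞) ^ n = 2 ^ n * 3 ^ n := by rw [← mul_pow]; norm_num
          rw [e1, mul_pow, mul_pow, e3, ← e2]
          ring
      _ = _ := by
          rw [ENNReal.tsum_mul_right, ENNReal.tsum_geometric, ENNReal.one_sub_inv_two, inv_inv, hK,
            Nat.factorial_succ]
          push_cast
          ring

section Peetre

variable {n : ℕ}

lemma one_add_enorm_add_le {E : Type*} [NormedAddCommGroup E] (x y : E) :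
    1 + ‖x + y‖ₑ ≤ (1 + ‖x‖ₑ) * (1 + ‖y‖ₑ) := by
  calc 1 + ‖x + y‖ₑ ≤ 1 + (‖x‖ₑ + ‖y‖ₑ) := by gcongr; exact enorm_add_le x y
    _ ≤ 1 + (‖x‖ₑ + ‖y‖ₑ) + ‖x‖ₑ * ‖y‖ₑ := le_self_add
    _ = _ := by ring

/-- Peetre's inequality for the weights `(1 + ‖x‖) ^ (-s)`. -/
lemma weight_mul_weight_le {E : Type*} [NormedAddCommGroup E] (x y z : E) {s : ℝ}
    (hs : 0 ≤ s) :
    (1 + ‖x - y‖ₑ) ^ (-s) * (1 + ‖y - z‖ₑ) ^ (-s) ≤ (1 + ‖x - z‖ₑ) ^ (-s) := by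
  have h := one_add_enorm_add_le (x - y) (y - z)
  rw [sub_add_sub_cancel] at h
  rw [← ENNReal.mul_rpow_of_ne_zero (by simp) (by simp)]
  rw [ENNReal.rpow_neg, ENNReal.rpow_neg]
  exact ENNReal.inv_le_inv.2 (ENNReal.rpow_le_rpow h hs)

lemma weight_anti {E : Type*} [NormedAddCommGroup E] (x : E) {s t : ℝ} (hst : s ≤ t) :
    (1 + ‖x‖ₑ) ^ (-t) ≤ (1 + ‖x‖ₑ) ^ (-s) :=
  ENNReal.rpow_le_rpow_of_exponent_le le_self_add (by linarith)

/-- The absorption step of the Strömberg–Torchinsky argument. -/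
lemma peetre_absorb {v : EuclideanSpace ℝ (Fin n) → ℝ≥0∞} (hv : Measurable v) {q s : ℝ}
    (hq : 0 < q) (hq1 : q ≤ 1) (hs : 0 ≤ s) {C : ℝ≥0∞}
    (hC : ∀ y, v y ≤ C * ∫⁻ z, v z * (1 + ‖y - z‖ₑ) ^ (-s)) (y : EuclideanSpace ℝ (Fin n))
    (hM : ⨆ z, v z * (1 + ‖y - z‖ₑ) ^ (-s) ≠ ⊤) :
    v y ^ q ≤ C * ∫⁻ w, v w ^ q * (1 + ‖y - w‖ₑ) ^ (-(s * q)) := by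
  set M := ⨆ z, v z * (1 + ‖y - z‖ₑ) ^ (-s) with hMdef
  set R := ∫⁻ w, v w ^ q * (1 + ‖y - w‖ₑ) ^ (-(s * q)) with hR
  have hvM (z) : v z * (1 + ‖y - z‖ₑ) ^ (-s) ≤ M := le_iSup_iff.2 fun b hb => hb z
  have hMR : M ≤ C * (R * M ^ (1 - q)) := by
    refine iSup_le fun z => ?_
    calc v z * (1 + ‖y - z‖ₑ) ^ (-s)
        ≤ (C * ∫⁻ w, v w * (1 + ‖z - w‖ₑ) ^ (-s)) * (1 + ‖y - z‖ₑ) ^ (-s) := by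
          gcongr; exact hC z
      _ = C * ∫⁻ w, v w * (1 + ‖z - w‖ₑ) ^ (-s) * (1 + ‖y - z‖ₑ) ^ (-s) := by
          rw [mul_assoc, lintegral_mul_const]
          fun_prop
      _ ≤ C * ∫⁻ w, v w ^ q * (1 + ‖y - w‖ₑ) ^ (-(s * q)) * M ^ (1 - q) := by
          refine mul_le_mul' le_rfl (lintegral_mono fun w => ?_)
          calc v w * (1 + ‖z - w‖ₑ) ^ (-s) * (1 + ‖y - z‖ₑ) ^ (-s)
              ≤ v w * (1 + ‖y - w‖ₑ) ^ (-s) := by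
                rw [mul_assoc, mul_comm (_ ^ (-s))]
                exact mul_le_mul' le_rfl (weight_mul_weight_le y z w hs)
            _ = (v w * (1 + ‖y - w‖ₑ) ^ (-s)) ^ q * (v w * (1 + ‖y - w‖ₑ) ^ (-s)) ^ (1 - q) := by
                rw [← ENNReal.rpow_add_of_nonneg _ _ hq.le (by linarith)]
                simp
            _ ≤ (v w * (1 + ‖y - w‖ₑ) ^ (-s)) ^ q * M ^ (1 - q) := by
                exact mul_le_mul' le_rfl (ENNReal.rpow_le_rpow (hvM w) (by linarith))
            _ = _ := by
                rw [ENNReal.mul_rpow_of_nonneg _ _ hq.le, ← ENNReal.rpow_mul, neg_mul]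
      _ = C * (R * M ^ (1 - q)) := by
          rw [lintegral_mul_const]
          fun_prop
  have hvy : v y ≤ M := by simpa using hvM y
  refine (ENNReal.rpow_le_rpow hvy hq.le).trans ?_
  rcases eq_or_ne M 0 with h0 | h0
  · simp [h0, hq]
  · have h1 : M ^ (1 - q) ≠ 0 := by simp [ENNReal.rpow_eq_zero_iff, h0, hM]
    have h2 : M ^ (1 - q) ≠ ⊤ := ENNReal.rpow_ne_top_of_nonneg (by linarith) hM
    refine (ENNReal.mul_le_mul_iff_left h1 h2).1 ?_
    rw [← ENNReal.rpow_add_of_nonneg _ _ hq.le (by linarith)]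
    simpa [mul_assoc] using hMR

/-- If `v` has polynomial growth and is dominated by its averages with respect to all weights
`(1 + ‖x‖) ^ (-s)`, then so are its small powers, with constants independent of the growth. -/
lemma rpow_le_lintegral_of_le_one {v : EuclideanSpace ℝ (Fin n) → ℝ≥0∞} (hv : Measurable v)
    {q s t : ℝ} (hq : 0 < q) (hq1 : q ≤ 1) (hs : 0 ≤ s) {C : ℝ → ℝ≥0∞} (hC0 : ∀ r, C r ≠ 0)
    (hCtop : ∀ r, C r ≠ ⊤)
    (hC : ∀ r y, v y ≤ C r * ∫⁻ z, v z * (1 + ‖y - z‖ₑ) ^ (-r))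
    {K : ℝ≥0∞} (hK : K ≠ ⊤) (hvK : ∀ z, v z ≤ K * (1 + ‖z‖ₑ) ^ t)
    (y : EuclideanSpace ℝ (Fin n)) :
    v y ^ q ≤ C s * ∫⁻ w, v w ^ q * (1 + ‖y - w‖ₑ) ^ (-(s * q)) := by
  set R := ∫⁻ w, v w ^ q * (1 + ‖y - w‖ₑ) ^ (-(s * q)) with hR
  rcases eq_or_ne R ⊤ with hRtop | hRtop
  · simp [hRtop, hC0]
  set t' := max s t
  have hst' : s ≤ t' := le_max_left _ _
  have ht' : 0 ≤ t' := hs.trans hst'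
  have hfin (z : EuclideanSpace ℝ (Fin n)) : ⨆ w, v w * (1 + ‖z - w‖ₑ) ^ (-t') ≠ ⊤ := by
    refine ne_top_of_le_ne_top (b := K * (1 + ‖z‖ₑ) ^ t')
      (ENNReal.mul_ne_top hK (ENNReal.rpow_ne_top_of_nonneg ht' (by simp))) (iSup_le fun w => ?_)
    have h1 : (1 + ‖w‖ₑ) ^ t ≤ (1 + ‖w‖ₑ) ^ t' :=
      ENNReal.rpow_le_rpow_of_exponent_le le_self_add (le_max_right _ _)
    have h2 : (1 + ‖w‖ₑ) ^ t' ≤ (1 + ‖z‖ₑ) ^ t' * (1 + ‖z - w‖ₑ) ^ t' := by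
      rw [← ENNReal.mul_rpow_of_nonneg _ _ ht']
      gcongr
      have := one_add_enorm_add_le z (w - z)
      rwa [add_sub_cancel, enorm_sub_rev] at this
    have h3 : (1 + ‖z - w‖ₑ) ^ t' * (1 + ‖z - w‖ₑ) ^ (-t') = 1 := by
      rw [← ENNReal.rpow_add _ _ (by simp) (by simp)]; simp
    calc v w * (1 + ‖z - w‖ₑ) ^ (-t')
        ≤ K * ((1 + ‖z‖ₑ) ^ t' * (1 + ‖z - w‖ₑ) ^ t') * (1 + ‖z - w‖ₑ) ^ (-t') := by
          gcongr
          exact (hvK w).trans (by gcongr; exact h1.trans h2)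
      _ = K * (1 + ‖z‖ₑ) ^ t' := by rw [mul_assoc, mul_assoc, h3, mul_one]
  have hst (z : EuclideanSpace ℝ (Fin n)) :
      v z ^ q ≤ C t' * ∫⁻ w, v w ^ q * (1 + ‖z - w‖ₑ) ^ (-(s * q)) := by
    refine (peetre_absorb hv hq hq1 ht' (hC t') z (hfin z)).trans ?_
    exact mul_le_mul' le_rfl (lintegral_mono fun w => mul_le_mul' le_rfl
      (weight_anti _ (by gcongr)))
  refine peetre_absorb hv hq hq1 hs (hC s) y ?_
  refine ne_top_of_le_ne_top (b := (C t' * R) ^ q⁻¹) (ENNReal.rpow_ne_top_of_nonneg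
    (by positivity) (ENNReal.mul_ne_top (hCtop _) hRtop)) (iSup_le fun z => ?_)
  rw [ENNReal.le_rpow_inv_iff hq, ENNReal.mul_rpow_of_nonneg _ _ hq.le, ← ENNReal.rpow_mul,
    neg_mul]
  calc v z ^ q * (1 + ‖y - z‖ₑ) ^ (-(s * q))
      ≤ (C t' * ∫⁻ w, v w ^ q * (1 + ‖z - w‖ₑ) ^ (-(s * q))) * (1 + ‖y - z‖ₑ) ^ (-(s * q)) := by
        gcongr; exact hst z
    _ = C t' * ∫⁻ w, v w ^ q * (1 + ‖z - w‖ₑ) ^ (-(s * q)) * (1 + ‖y - z‖ₑ) ^ (-(s * q)) := by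
        rw [mul_assoc, lintegral_mul_const]
        fun_prop
    _ ≤ C t' * R := by
        rw [hR]
        refine mul_le_mul' le_rfl (lintegral_mono fun w => ?_)
        rw [mul_assoc, mul_comm (_ ^ (-(s * q)))]
        exact mul_le_mul' le_rfl (weight_mul_weight_le y z w (by positivity))

lemma lintegral_weight_ne_top {s : ℝ} (hs : (n : ℝ) < s) :
    ∫⁻ x : EuclideanSpace ℝ (Fin n), (1 + ‖x‖ₑ) ^ (-s) ≠ ⊤ := by
  have h := finite_integral_one_add_norm (E := EuclideanSpace ℝ (Fin n)) (μ := volume)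
    (r := s) (by simpa using hs)
  refine ne_top_of_le_ne_top h.ne (le_of_eq (lintegral_congr fun x => ?_))
  rw [← ENNReal.ofReal_rpow_of_pos (by positivity), ENNReal.ofReal_add (by simp) (by simp),
    ofReal_norm, ENNReal.ofReal_one]

/-- If `v` has polynomial growth and is dominated by its averages with respect to all weights
`(1 + ‖x‖) ^ (-s)`, then so are all its powers, with constants independent of `v`. -/
lemma exists_rpow_le_lintegral {q s : ℝ} (hq : 0 < q) (hs : (n : ℝ) < s) {C : ℝ → ℝ≥0∞}
    (hC0 : ∀ r, C r ≠ 0) (hCtop : ∀ r, C r ≠ ⊤) :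
    ∃ C' : ℝ≥0∞, C' ≠ ⊤ ∧ ∀ v : EuclideanSpace ℝ (Fin n) → ℝ≥0∞, Measurable v →
      (∀ r y, v y ≤ C r * ∫⁻ z, v z * (1 + ‖y - z‖ₑ) ^ (-r)) →
      (∃ K : ℝ≥0∞, K ≠ ⊤ ∧ ∃ t : ℝ, ∀ z, v z ≤ K * (1 + ‖z‖ₑ) ^ t) →
      ∀ y, v y ^ q ≤ C' * ∫⁻ w, v w ^ q * (1 + ‖y - w‖ₑ) ^ (-s) := by
  have hs0 : 0 < s := (Nat.cast_nonneg n).trans_lt hs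
  rcases le_or_gt q 1 with hq1 | hq1
  · refine ⟨C (s / q), hCtop _, fun v hv hC ⟨K, hK, t, hvK⟩ y => ?_⟩
    have h := rpow_le_lintegral_of_le_one hv hq hq1 (s := s / q) (by positivity) hC0 hCtop hC hK
      hvK y
    rwa [div_mul_cancel₀ _ hq.ne'] at h
  · set I := ∫⁻ x : EuclideanSpace ℝ (Fin n), (1 + ‖x‖ₑ) ^ (-s)
    refine ⟨C s ^ q * I ^ (q - 1), ENNReal.mul_ne_top
      (ENNReal.rpow_ne_top_of_nonneg hq.le (hCtop _)) (ENNReal.rpow_ne_top_of_nonneg (by linarith)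
        (lintegral_weight_ne_top hs)), fun v hv hC _ y => ?_⟩
    have hpq : q.HolderConjugate (q / (q - 1)) := Real.HolderConjugate.conjExponent hq1
    have hI : ∫⁻ w, (1 + ‖y - w‖ₑ) ^ (-s) = I :=
      lintegral_sub_left_eq_self (fun x : EuclideanSpace ℝ (Fin n) => (1 + ‖x‖ₑ) ^ (-s)) y
    have hH := ENNReal.lintegral_mul_le_Lp_mul_Lq volume hpq
      (f := fun w => v w * (1 + ‖y - w‖ₑ) ^ (-s / q))
      (g := fun w => (1 + ‖y - w‖ₑ) ^ (-s * ((q - 1) / q))) (by fun_prop) (by fun_prop)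
    have e1 : ∫⁻ w, v w * (1 + ‖y - w‖ₑ) ^ (-s) = ∫⁻ w, ((fun w => v w * (1 + ‖y - w‖ₑ) ^ (-s / q))
        * (fun w => (1 + ‖y - w‖ₑ) ^ (-s * ((q - 1) / q)))) w := by
      refine lintegral_congr fun w => ?_
      rw [Pi.mul_apply, mul_assoc, ← ENNReal.rpow_add _ _ (by simp) (by simp)]
      congr 2
      field_simp
      ring
    have e2 : ∫⁻ w, (v w * (1 + ‖y - w‖ₑ) ^ (-s / q)) ^ q =
        ∫⁻ w, v w ^ q * (1 + ‖y - w‖ₑ) ^ (-s) := by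
      refine lintegral_congr fun w => ?_
      rw [ENNReal.mul_rpow_of_nonneg _ _ hq.le, ← ENNReal.rpow_mul, div_mul_cancel₀ _ hq.ne']
    have e3 : ∫⁻ w, ((1 + ‖y - w‖ₑ) ^ (-s * ((q - 1) / q))) ^ (q / (q - 1)) = I := by
      rw [← hI]
      refine lintegral_congr fun w => ?_
      rw [← ENNReal.rpow_mul, mul_assoc, div_mul_div_cancel₀' (by linarith), div_self (by linarith),
        mul_one]
    rw [e2, e3, ← e1] at hH
    calc v y ^ q ≤ (C s * ((∫⁻ w, v w ^ q * (1 + ‖y - w‖ₑ) ^ (-s)) ^ (1 / q) *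
          I ^ (1 / (q / (q - 1))))) ^ q := by
          gcongr
          exact (hC s y).trans (by gcongr)
      _ = _ := by
          rw [ENNReal.mul_rpow_of_nonneg _ _ hq.le, ENNReal.mul_rpow_of_nonneg _ _ hq.le,
            ← ENNReal.rpow_mul, ← ENNReal.rpow_mul, one_div_mul_cancel hq.ne', ENNReal.rpow_one,
            one_div_div, div_mul_cancel₀ _ hq.ne']
          ring

end Peetre

section Translation

variable {E : Type*} [NormedAddCommGroup E] [NormedSpace ℝ E]

lemma norm_pow_mul_iteratedFDeriv_translate_le (φ : 𝓢(E, ℂ)) (k m : ℕ) :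
    ∃ C : ℝ, 0 ≤ C ∧ ∀ a x, ‖x‖ ^ k * ‖iteratedFDeriv ℝ m φ (x - a)‖ ≤ C * (1 + ‖a‖) ^ k := by
  refine ⟨2 ^ k * (Finset.Iic (k, m)).sup (fun m => SchwartzMap.seminorm ℂ m.1 m.2) φ,
    mul_nonneg (by positivity) (apply_nonneg _ _), fun a x => ?_⟩
  have h := SchwartzMap.one_add_le_sup_seminorm_apply (𝕜 := ℂ) (m := (k, m)) le_rfl le_rfl φ (x - a)
  have h1 : ‖x‖ ≤ (1 + ‖x - a‖) * (1 + ‖a‖) := by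
    have := norm_add_le (x - a) a
    rw [sub_add_cancel] at this
    nlinarith [norm_nonneg (x - a), norm_nonneg a]
  calc ‖x‖ ^ k * ‖iteratedFDeriv ℝ m φ (x - a)‖
      ≤ ((1 + ‖x - a‖) * (1 + ‖a‖)) ^ k * ‖iteratedFDeriv ℝ m φ (x - a)‖ := by gcongr
    _ = (1 + ‖x - a‖) ^ k * ‖iteratedFDeriv ℝ m φ (x - a)‖ * (1 + ‖a‖) ^ k := by
        rw [mul_pow]; ring
    _ ≤ _ := by gcongr

lemma iteratedFDeriv_translate (φ : 𝓢(E, ℂ)) (m : ℕ) (a x : E) :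
    iteratedFDeriv ℝ m (φ.compSubConstCLM ℂ a) x = iteratedFDeriv ℝ m φ (x - a) :=
  iteratedFDeriv_comp_sub m a x

lemma seminorm_translate_le (φ : 𝓢(E, ℂ)) (k m : ℕ) :
    ∃ C : ℝ, 0 ≤ C ∧ ∀ a, SchwartzMap.seminorm ℂ k m (φ.compSubConstCLM ℂ a) ≤
      C * (1 + ‖a‖) ^ k := by
  obtain ⟨C, hC, h⟩ := norm_pow_mul_iteratedFDeriv_translate_le φ k m
  refine ⟨C, hC, fun a => SchwartzMap.seminorm_le_bound ℂ k m _ (by positivity) fun x => ?_⟩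
  rw [iteratedFDeriv_translate]
  exact h a x

lemma seminorm_translate_sub_translate_le (φ : 𝓢(E, ℂ)) (k m : ℕ) :
    ∃ C : ℝ, 0 ≤ C ∧ ∀ a b, SchwartzMap.seminorm ℂ k m
      (φ.compSubConstCLM ℂ a - φ.compSubConstCLM ℂ b) ≤
        C * (1 + max ‖a‖ ‖b‖) ^ k * ‖a - b‖ := by
  obtain ⟨C, hC, h⟩ := norm_pow_mul_iteratedFDeriv_translate_le φ k (m + 1)
  refine ⟨C, hC, fun a b => SchwartzMap.seminorm_le_bound ℂ k m _ (by positivity) fun x => ?_⟩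
  have hsub : iteratedFDeriv ℝ m ⇑(φ.compSubConstCLM ℂ a - φ.compSubConstCLM ℂ b) x =
      iteratedFDeriv ℝ m φ (x - a) - iteratedFDeriv ℝ m φ (x - b) := by
    rw [← iteratedFDeriv_translate, ← iteratedFDeriv_translate]
    exact iteratedFDeriv_sub_apply (SchwartzMap.smooth _ m).contDiffAt
      (SchwartzMap.smooth _ m).contDiffAt
  rw [hsub]
  have hd : Differentiable ℝ (iteratedFDeriv ℝ m φ) :=
    (φ.smooth (m + 1)).differentiable_iteratedFDeriv (by exact_mod_cast Nat.lt_succ_self m)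
  have hmv := (convex_closedBall (0 : E) (max ‖a‖ ‖b‖)).norm_image_sub_le_of_norm_fderiv_le
    (𝕜 := ℝ) (f := fun s => ‖x‖ ^ k • iteratedFDeriv ℝ m φ (x - s))
    (C := C * (1 + max ‖a‖ ‖b‖) ^ k) (x := b) (y := a) (fun s _ => by fun_prop) (fun s hs => ?_)
    (by simp) (by simp)
  · rwa [← smul_sub, norm_smul, norm_pow, norm_norm] at hmv
  · have e : fderiv ℝ (fun s => ‖x‖ ^ k • iteratedFDeriv ℝ m φ (x - s)) s =
        ‖x‖ ^ k • fderiv ℝ (fun s => iteratedFDeriv ℝ m φ (x - s)) s :=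
      fderiv_fun_const_smul (hd.comp (differentiable_id.const_sub x)).differentiableAt _
    have e' : fderiv ℝ (fun s => iteratedFDeriv ℝ m φ (x - s)) s =
        -fderiv ℝ (iteratedFDeriv ℝ m φ) (x - s) := by
      have := (hd (x - s)).hasFDerivAt.comp s ((hasFDerivAt_id s).const_sub x)
      refine this.fderiv.trans ?_
      ext1 y
      simp
    rw [e, e', norm_smul, norm_pow, norm_norm,
      norm_neg, norm_fderiv_iteratedFDeriv]
    refine (h s x).trans ?_
    gcongr
    simpa using hs

lemma continuous_translate (φ : 𝓢(E, ℂ)) : Continuous fun a => φ.compSubConstCLM ℂ a := by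
  refine continuous_iff_continuousAt.2 fun b => ?_
  refine ((schwartz_withSeminorms ℂ E ℂ).tendsto_nhds _ _).2 fun ⟨k, m⟩ ε hε => ?_
  obtain ⟨C, hC, h⟩ := seminorm_translate_sub_translate_le φ k m
  have ht : Filter.Tendsto (fun a => C * (1 + max ‖a‖ ‖b‖) ^ k * ‖a - b‖) (nhds b) (nhds 0) := by
    have : Continuous (fun a => C * (1 + max ‖a‖ ‖b‖) ^ k * ‖a - b‖) := by fun_prop
    simpa using this.tendsto b
  filter_upwards [ht.eventually (gt_mem_nhds hε)] with a ha
  exact (h a b).trans_lt ha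

end Translation

section Convolution

variable {V : Type*} [NormedAddCommGroup V] [InnerProductSpace ℝ V] [FiniteDimensional ℝ V]
  [MeasurableSpace V] [BorelSpace V]

open LineDeriv

lemma lineDerivOp_convolution (η φ : 𝓢(V, ℂ)) (v : V) :
    ∂_{v} (SchwartzMap.convolution (ContinuousLinearMap.mul ℂ ℂ) η φ) =
      SchwartzMap.convolution (ContinuousLinearMap.mul ℂ ℂ) η (∂_{v} φ) := by
  have hinj : Function.Injective (𝓕 : 𝓢(V, ℂ) → 𝓢(V, ℂ)) :=
    (FourierTransform.fourierEquiv ℂ 𝓢(V, ℂ)).injective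
  apply hinj
  have hg : (inner ℝ · v : V → ℝ).HasTemperateGrowth := ((innerSL ℝ).flip v).hasTemperateGrowth
  ext x
  simp [SchwartzMap.fourier_lineDerivOp_eq, SchwartzMap.fourier_convolution, hg]
  ring

lemma iteratedLineDerivOp_convolution (η φ : 𝓢(V, ℂ)) {m : ℕ} (v : Fin m → V) :
    ∂^{v} (SchwartzMap.convolution (ContinuousLinearMap.mul ℂ ℂ) η φ) =
      SchwartzMap.convolution (ContinuousLinearMap.mul ℂ ℂ) η (∂^{v} φ) := by
  induction m with
  | zero => simp
  | succ m ih => rw [iteratedLineDerivOp_succ_left, ih, lineDerivOp_convolution,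
      iteratedLineDerivOp_succ_left]

end Convolution

section Interchange

variable {V : Type*} [NormedAddCommGroup V] [InnerProductSpace ℝ V]

open BoundedContinuousFunction LineDeriv

/-- Bounded continuous functions with values in a normed group. -/
abbrev NBCF (V G : Type*) [TopologicalSpace V] [NormedAddCommGroup G] := V →ᵇ G

/-- The map `f ↦ ‖x‖ ^ k • D ^ m f` from Schwartz functions to bounded continuous functions. -/
def weightedDeriv (k m : ℕ) : 𝓢(V, ℂ) →ₗ[ℂ] (NBCF V (V [×m]→L[ℝ] ℂ)) where
  toFun f := BoundedContinuousFunction.ofNormedAddCommGroup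
    (fun x => ‖x‖ ^ k • iteratedFDeriv ℝ m f x)
    ((continuous_norm.pow k).smul ((f.smooth m).continuous_iteratedFDeriv le_rfl))
    (SchwartzMap.seminorm ℂ k m f) fun x => by
      rw [norm_smul, norm_pow, norm_norm]
      exact SchwartzMap.le_seminorm ℂ k m f x
  map_add' f g := by
    ext1 x
    have : iteratedFDeriv ℝ m ⇑(f + g) x = iteratedFDeriv ℝ m f x + iteratedFDeriv ℝ m g x :=
      iteratedFDeriv_add_apply (f.smooth m).contDiffAt (g.smooth m).contDiffAt
    change ‖x‖ ^ k • iteratedFDeriv ℝ m ⇑(f + g) x = _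
    rw [this, smul_add]
    rfl
  map_smul' c f := by
    ext1 x
    have : iteratedFDeriv ℝ m ⇑(c • f) x = c • iteratedFDeriv ℝ m f x :=
      iteratedFDeriv_const_smul_apply (f.smooth m).contDiffAt
    change ‖x‖ ^ k • iteratedFDeriv ℝ m ⇑(c • f) x = _
    rw [this, smul_comm]
    rfl

lemma weightedDeriv_apply (k m : ℕ) (f : 𝓢(V, ℂ)) (x : V) :
    weightedDeriv k m f x = ‖x‖ ^ k • iteratedFDeriv ℝ m f x := rfl

lemma norm_weightedDeriv (k m : ℕ) (f : 𝓢(V, ℂ)) :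
    ‖weightedDeriv k m f‖ = SchwartzMap.seminorm ℂ k m f := by
  refine le_antisymm ((BoundedContinuousFunction.norm_le (apply_nonneg _ _)).2 fun x => ?_)
    (SchwartzMap.seminorm_le_bound ℂ k m f (norm_nonneg _) fun x => ?_)
  · rw [weightedDeriv_apply, norm_smul, norm_pow, norm_norm]
    exact SchwartzMap.le_seminorm ℂ k m f x
  · have := (weightedDeriv k m f).norm_coe_le_norm x
    rwa [weightedDeriv_apply, norm_smul, norm_pow, norm_norm] at this

/-- A tempered distribution is controlled by finitely many Schwartz seminorms. -/
lemma exists_norm_le_sup_seminorm (T : 𝓢(V, ℂ) →L[ℂ] ℂ) :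
    ∃ (s : Finset (ℕ × ℕ)) (C : ℝ), 0 ≤ C ∧
      ∀ f, ‖T f‖ ≤ C * s.sup (schwartzSeminormFamily ℂ V ℂ) f := by
  obtain ⟨s, C, -, h⟩ := Seminorm.bound_of_continuous (schwartz_withSeminorms ℂ V ℂ)
    ((normSeminorm ℂ ℂ).comp T.toLinearMap) (T.continuous.norm)
  exact ⟨s, C, C.2, fun f => h f⟩

/-- A functional dominated by the norm of an injective linear map factors through that map. -/
lemma exists_continuous_extension_of_norm_le {A X : Type*} [AddCommGroup A] [Module ℂ A]
    [NormedAddCommGroup X] [NormedSpace ℂ X] (ι : A →ₗ[ℂ] X) (hι : Function.Injective ι)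
    (T : A →ₗ[ℂ] ℂ) (C : ℝ) (h : ∀ f, ‖T f‖ ≤ C * ‖ι f‖) :
    ∃ L : X →L[ℂ] ℂ, ∀ f, T f = L (ι f) := by
  set e := LinearEquiv.ofInjective ι hι
  obtain ⟨L, hL, -⟩ := exists_extension_norm_eq (𝕜 := ℂ) (LinearMap.range ι)
    ((T ∘ₗ e.symm.toLinearMap).mkContinuous C fun g => by
      obtain ⟨f, rfl⟩ := e.surjective g
      have he : (e f : X) = ι f := rfl
      simpa [he] using h f)
  refine ⟨L, fun f => ?_⟩
  have he : (e f : X) = ι f := rfl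
  simpa [he] using (hL (e f)).symm

/-- A tempered distribution extends to a continuous functional on a product of spaces of bounded
continuous functions. -/
lemma exists_eq_comp_weightedDeriv (T : 𝓢(V, ℂ) →L[ℂ] ℂ) :
    ∃ (s : Finset (ℕ × ℕ)) (L : (Π i : s, NBCF V (V [×i.1.2]→L[ℝ] ℂ)) →L[ℂ] ℂ),
      ∀ f, T f = L fun i => weightedDeriv i.1.1 i.1.2 f := by
  obtain ⟨s₀, C, hC, h⟩ := exists_norm_le_sup_seminorm T
  set s := insert (0, 0) s₀
  set ι : 𝓢(V, ℂ) →ₗ[ℂ] (Π i : s, NBCF V (V [×i.1.2]→L[ℝ] ℂ)) :=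
    LinearMap.pi fun i => weightedDeriv i.1.1 i.1.2 with hι
  have hιinj : Function.Injective ι := by
    refine (injective_iff_map_eq_zero ι).2 fun f hf => ?_
    have h0 : weightedDeriv 0 0 f = 0 := congrFun hf ⟨(0, 0), Finset.mem_insert_self _ _⟩
    ext x
    have h1 := congrArg (fun g => g x 0) h0
    simpa [weightedDeriv_apply] using h1
  have hbound (f : 𝓢(V, ℂ)) : ‖T f‖ ≤ C * ‖ι f‖ := by
    refine (h f).trans ?_
    gcongr
    refine Seminorm.finset_sup_apply_le (norm_nonneg _) fun i hi => ?_
    refine le_trans (norm_weightedDeriv i.1 i.2 f).symm.le ?_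
    exact norm_le_pi_norm (ι f) ⟨i, Finset.mem_insert_of_mem hi⟩
  obtain ⟨L, hL⟩ := exists_continuous_extension_of_norm_le ι hιinj T.toLinearMap C hbound
  exact ⟨s, L, hL⟩

/-- Translates of a Schwartz function tested against a tempered distribution give a function
of polynomial growth. -/
lemma exists_norm_apply_translate_le (T : 𝓢(V, ℂ) →L[ℂ] ℂ) (φ : 𝓢(V, ℂ)) :
    ∃ (C : ℝ) (N : ℕ), 0 ≤ C ∧ ∀ a, ‖T (φ.compSubConstCLM ℂ a)‖ ≤ C * (1 + ‖a‖) ^ N := by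
  obtain ⟨s, C, hC, h⟩ := exists_norm_le_sup_seminorm T
  choose D hD hDa using fun i : ℕ × ℕ => seminorm_translate_le φ i.1 i.2
  refine ⟨C * ∑ i ∈ s, D i, s.sup Prod.fst, mul_nonneg hC (Finset.sum_nonneg fun i _ => hD i),
    fun a => (h _).trans ?_⟩
  rw [mul_assoc]
  gcongr
  refine Seminorm.finset_sup_apply_le (mul_nonneg (Finset.sum_nonneg fun i _ => hD i)
    (by positivity)) fun i hi => (hDa i a).trans ?_
  have h1 : (1 : ℝ) ≤ 1 + ‖a‖ := by simp
  exact mul_le_mul (Finset.single_le_sum (fun i _ => hD i) hi)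
    (pow_le_pow_right₀ h1 (Finset.le_sup (f := Prod.fst) hi)) (by positivity)
    (Finset.sum_nonneg fun i _ => hD i)

variable [FiniteDimensional ℝ V] [MeasurableSpace V] [BorelSpace V]

lemma integrable_schwartz_mul_pow (η : 𝓢(V, ℂ)) (N : ℕ) :
    Integrable fun a => ‖η a‖ * (1 + ‖a‖) ^ N := by
  simp_rw [add_comm (1 : ℝ), add_pow, one_pow, mul_one, Finset.mul_sum]
  refine integrable_finsetSum _ fun i _ => ?_
  refine ((η.integrable_pow_mul volume i).mul_const (N.choose i : ℝ)).congr
    (Filter.Eventually.of_forall fun a => ?_)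
  ring

/-- Tempered distributions commute with the integral defining a convolution. -/
lemma apply_convolution_eq_integral (T : 𝓢(V, ℂ) →L[ℂ] ℂ) (η φ : 𝓢(V, ℂ)) :
    T (SchwartzMap.convolution (ContinuousLinearMap.mul ℂ ℂ) η φ) =
      ∫ a, η a * T (φ.compSubConstCLM ℂ a) := by
  obtain ⟨s, L, hL⟩ := exists_eq_comp_weightedDeriv T
  set τ : V → (Π i : s, NBCF V (V [×i.1.2]→L[ℝ] ℂ)) := fun a i =>
    weightedDeriv i.1.1 i.1.2 (φ.compSubConstCLM ℂ a) with hτ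
  have hτc : Continuous τ := by
    refine continuous_pi fun i => ?_
    have : Continuous (weightedDeriv (V := V) i.1.1 i.1.2) := by
      refine (schwartz_withSeminorms ℂ V ℂ).continuous_normedSpace_rng _ _
        ⟨{i.1}, 1, fun f => ?_⟩
      rw [Finset.sup_singleton, one_smul]
      exact (norm_weightedDeriv i.1.1 i.1.2 f).le
    exact this.comp (continuous_translate φ)
  have hτi (i : s) : Integrable fun a => η a • τ a i := by
    obtain ⟨C, hC, h⟩ := seminorm_translate_le φ i.1.1 i.1.2
    refine ((integrable_schwartz_mul_pow η i.1.1).const_mul C).mono'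
      (η.continuous.smul (continuous_pi_iff.1 hτc i)).aestronglyMeasurable
      (Filter.Eventually.of_forall fun a => ?_)
    rw [norm_smul, norm_weightedDeriv]
    calc _ ≤ ‖η a‖ * (C * (1 + ‖a‖) ^ i.1.1) := by gcongr; exact h a
      _ = _ := by ring
  have hτiτ : Integrable fun a => η a • τ a := Integrable.of_eval hτi
  have key : ∫ a, η a • τ a = fun i : s => weightedDeriv i.1.1 i.1.2
      (SchwartzMap.convolution (ContinuousLinearMap.mul ℂ ℂ) η φ) := by
    ext i x v
    have h0 : (∫ a, η a • τ a) i = ∫ a, η a • τ a i := eval_integral (f := fun a => η a • τ a) hτi i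
    have h1 := (BoundedContinuousFunction.evalCLM ℂ x).integral_comp_comm (hτi i)
    have h2 := (ContinuousMultilinearMap.apply ℝ (fun _ : Fin i.1.2 => V) ℂ v).integral_comp_comm
      ((BoundedContinuousFunction.evalCLM ℂ x).integrable_comp (hτi i))
    simp only [BoundedContinuousFunction.evalCLM_apply] at h1 h2
    rw [h0, ← h1]
    refine h2.symm.trans ?_
    have e : weightedDeriv i.1.1 i.1.2
        (SchwartzMap.convolution (ContinuousLinearMap.mul ℂ ℂ) η φ) x v =
          ‖x‖ ^ i.1.1 • ∫ a, η a * (∂^{v} φ) (x - a) := by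
      change ‖x‖ ^ i.1.1 • iteratedFDeriv ℝ i.1.2
        (SchwartzMap.convolution (ContinuousLinearMap.mul ℂ ℂ) η φ) x v = _
      rw [← SchwartzMap.iteratedLineDerivOp_eq_iteratedFDeriv, iteratedLineDerivOp_convolution,
        SchwartzMap.convolution_apply]
      rfl
    rw [e, ← integral_smul]
    refine integral_congr_ae (Filter.Eventually.of_forall fun a => ?_)
    change η a • (‖x‖ ^ i.1.1 • iteratedFDeriv ℝ i.1.2 (φ.compSubConstCLM ℂ a) x v) = _
    rw [iteratedFDeriv_translate, ← SchwartzMap.iteratedLineDerivOp_eq_iteratedFDeriv, smul_comm]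
    rfl
  rw [hL, ← key, ← L.integral_comp_comm hτiτ]
  refine integral_congr_ae (Filter.Eventually.of_forall fun a => ?_)
  simp only [map_smul, smul_eq_mul, hL]
  rfl

end Interchange

section Reproducing

variable {V : Type*} [NormedAddCommGroup V] [InnerProductSpace ℝ V] [FiniteDimensional ℝ V]
  [MeasurableSpace V] [BorelSpace V]

open Convolution

/-- A band-limited Schwartz function is reproduced by convolution with a Schwartz function. -/
lemma exists_convolution_eq_self (φ : 𝓢(V, ℂ)) {R : ℝ} (hR : 0 < R)
    (hφ : ∀ ξ, R ≤ ‖ξ‖ → 𝓕 ⇑φ ξ = 0) :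
    ∃ ψ : 𝓢(V, ℂ), SchwartzMap.convolution (ContinuousLinearMap.mul ℂ ℂ) ψ φ = φ := by
  set χ : ContDiffBump (0 : V) := ⟨R, R + 1, hR, by linarith⟩
  have hχs : HasCompactSupport fun x => (χ x : ℂ) :=
    χ.hasCompactSupport.comp_left (g := ((↑) : ℝ → ℂ)) Complex.ofReal_zero
  have hχd : ContDiff ℝ (⊤ : ℕ∞) fun x => (χ x : ℂ) :=
    Complex.ofRealCLM.contDiff.comp χ.contDiff
  refine ⟨𝓕⁻ (hχs.toSchwartzMap hχd), ?_⟩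
  apply (FourierTransform.fourierEquiv ℂ 𝓢(V, ℂ)).injective
  change 𝓕 (SchwartzMap.convolution (ContinuousLinearMap.mul ℂ ℂ)
    (𝓕⁻ (hχs.toSchwartzMap hχd)) φ) = 𝓕 φ
  rw [SchwartzMap.fourier_convolution, FourierTransform.fourier_fourierInv_eq]
  ext ξ
  rw [SchwartzMap.pairing_apply_apply, ContinuousLinearMap.mul_apply', SchwartzMap.fourier_coe]
  rcases le_total R ‖ξ‖ with h | h
  · rw [hφ ξ h, mul_zero]
  · have : χ ξ = 1 := χ.one_of_mem_closedBall (by simpa using h)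
    simp [this]

lemma translate_convolution (ψ φ : 𝓢(V, ℂ)) (a : V) :
    (SchwartzMap.convolution (ContinuousLinearMap.mul ℂ ℂ) ψ φ).compSubConstCLM ℂ a =
      SchwartzMap.convolution (ContinuousLinearMap.mul ℂ ℂ) (ψ.compSubConstCLM ℂ a) φ := by
  ext x
  rw [SchwartzMap.compSubConstCLM_apply, SchwartzMap.convolution_apply,
    SchwartzMap.convolution_apply]
  change ∫ t, ψ t * φ (x - a - t) = ∫ t, ψ (t - a) * φ (x - t)
  rw [← integral_sub_right_eq_self (fun t => ψ t * φ (x - a - t)) a]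
  simp

lemma apply_translate_eq_integral {ψ φ : 𝓢(V, ℂ)}
    (h : SchwartzMap.convolution (ContinuousLinearMap.mul ℂ ℂ) ψ φ = φ) (T : 𝓢(V, ℂ) →L[ℂ] ℂ)
    (w : V) :
    T (φ.compSubConstCLM ℂ (-w)) = ∫ z, ψ (w - z) * T (φ.compSubConstCLM ℂ (-z)) := by
  nth_rewrite 1 [← h]
  rw [translate_convolution, apply_convolution_eq_integral,
    ← integral_neg_eq_self (fun a => _ * _)]
  refine integral_congr_ae (Filter.Eventually.of_forall fun z => ?_)
  simp only [SchwartzMap.compSubConstCLM_apply]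
  congr 2
  abel

end Reproducing

lemma exists_enorm_le_weight {E : Type*} [NormedAddCommGroup E] [NormedSpace ℝ E] (ψ : 𝓢(E, ℂ))
    (r : ℝ) :
    ∃ C : ℝ≥0∞, C ≠ 0 ∧ C ≠ ⊤ ∧ ∀ x, ‖ψ x‖ₑ ≤ C * (1 + ‖x‖ₑ) ^ (-r) := by
  set k := ⌈r⌉₊
  set S := 2 ^ k * (Finset.Iic (k, 0)).sup (fun m => SchwartzMap.seminorm ℂ m.1 m.2) ψ
  have hS : 0 ≤ S := mul_nonneg (by positivity) (apply_nonneg _ _)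
  refine ⟨ENNReal.ofReal S + 1, by simp, by simp, fun x => ?_⟩
  have h := SchwartzMap.one_add_le_sup_seminorm_apply (𝕜 := ℂ) (m := (k, 0)) le_rfl le_rfl ψ x
  rw [norm_iteratedFDeriv_zero] at h
  have h1 : (1 + ‖x‖ₑ) ^ r * ‖ψ x‖ₑ ≤ ENNReal.ofReal S := by
    calc (1 + ‖x‖ₑ) ^ r * ‖ψ x‖ₑ ≤ (1 + ‖x‖ₑ) ^ (k : ℝ) * ‖ψ x‖ₑ :=
          mul_le_mul' (ENNReal.rpow_le_rpow_of_exponent_le le_self_add (Nat.le_ceil r)) le_rfl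
      _ = ENNReal.ofReal ((1 + ‖x‖) ^ k * ‖ψ x‖) := by
          rw [ENNReal.rpow_natCast, ENNReal.ofReal_mul (by positivity), ENNReal.ofReal_pow
            (by positivity), ENNReal.ofReal_add (by simp) (by simp), ofReal_norm, ofReal_norm,
            ENNReal.ofReal_one]
      _ ≤ _ := ENNReal.ofReal_le_ofReal h
  rw [ENNReal.rpow_neg, ← div_eq_mul_inv, ENNReal.le_div_iff_mul_le (by simp) (by simp), mul_comm]
  exact h1.trans le_self_add

/-- Peetre-type domination of powers of a band-limited function by their weighted averages. -/
lemma exists_enorm_apply_translate_rpow_le {n : ℕ} {q s : ℝ} (hq : 0 < q) (hs : (n : ℝ) < s)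
    (φ : 𝓢(EuclideanSpace ℝ (Fin n), ℂ)) {R : ℝ} (hR : 0 < R)
    (hφ : ∀ ξ, R ≤ ‖ξ‖ → 𝓕 ⇑φ ξ = 0) :
    ∃ C : ℝ≥0∞, C ≠ ⊤ ∧ ∀ (T : 𝓢(EuclideanSpace ℝ (Fin n), ℂ) →L[ℂ] ℂ) y,
      ‖T (φ.compSubConstCLM ℂ (-y))‖ₑ ^ q ≤
        C * ∫⁻ w, ‖T (φ.compSubConstCLM ℂ (-w))‖ₑ ^ q * (1 + ‖y - w‖ₑ) ^ (-s) := by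
  obtain ⟨ψ, hψ⟩ := exists_convolution_eq_self φ hR hφ
  choose D hD0 hDtop hD using exists_enorm_le_weight ψ
  obtain ⟨C, hC, h⟩ := exists_rpow_le_lintegral hq hs hD0 hDtop
  refine ⟨C, hC, fun T => h (fun w => ‖T (φ.compSubConstCLM ℂ (-w))‖ₑ) ?_ ?_ ?_⟩
  · exact (T.continuous.comp ((continuous_translate φ).comp continuous_neg)).enorm.measurable
  · intro r y
    calc ‖T (φ.compSubConstCLM ℂ (-y))‖ₑ
        ≤ ∫⁻ z, ‖ψ (y - z) * T (φ.compSubConstCLM ℂ (-z))‖ₑ := by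
          rw [apply_translate_eq_integral hψ T y]
          exact enorm_integral_le_lintegral_enorm _
      _ ≤ ∫⁻ z, D r * (‖T (φ.compSubConstCLM ℂ (-z))‖ₑ * (1 + ‖y - z‖ₑ) ^ (-r)) := by
          refine lintegral_mono fun z => ?_
          rw [enorm_mul]
          calc _ ≤ D r * (1 + ‖y - z‖ₑ) ^ (-r) * ‖T (φ.compSubConstCLM ℂ (-z))‖ₑ :=
                mul_le_mul' (hD r _) le_rfl
            _ = _ := by ring
      _ = _ := lintegral_const_mul' _ _ (hDtop r)
  · obtain ⟨K, N, hK, hKN⟩ := exists_norm_apply_translate_le T φ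
    refine ⟨ENNReal.ofReal K, by simp, N, fun z => ?_⟩
    rw [ENNReal.rpow_natCast, ← ofReal_norm, ← ofReal_norm, ← ENNReal.ofReal_one,
      ← ENNReal.ofReal_add (by simp) (by simp), ← ENNReal.ofReal_pow (by positivity),
      ← ENNReal.ofReal_mul hK]
    exact ENNReal.ofReal_le_ofReal (by simpa using hKN (-z))

section Scaling

variable {n : ℕ}

lemma weight_le_tsum {E : Type*} [NormedAddCommGroup E] (N : ℕ) (x : E) :
    (1 + ‖x‖ₑ) ^ (-(N : ℝ)) ≤
      2 ^ N * ∑' l : ℕ, (2⁻¹ : ℝ≥0∞) ^ (l * N) * (Metric.ball (0 : E) (2 ^ l)).indicator 1 x := by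
  have hex : ∃ l : ℕ, ‖x‖ < 2 ^ l := pow_unbounded_of_one_lt _ one_lt_two
  set l := Nat.find hex with hl
  have hlx : x ∈ Metric.ball (0 : E) (2 ^ l) := by simpa using Nat.find_spec hex
  refine le_trans ?_ (mul_le_mul' le_rfl (ENNReal.le_tsum l))
  rw [indicator_of_mem hlx, Pi.one_apply, mul_one, pow_mul, ← mul_pow, ENNReal.rpow_neg,
    ENNReal.rpow_natCast, ENNReal.inv_pow]
  refine pow_le_pow_left₀ zero_le ?_ N
  rcases hl0 : l with _ | j
  · rw [pow_zero, mul_one]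
    exact (ENNReal.inv_le_one.2 le_self_add).trans one_le_two
  · have hj : (2 : ℝ) ^ j ≤ ‖x‖ := not_lt.1 (Nat.find_min hex (by omega))
    have hj' : (2 : ℝ≥0∞) ^ j ≤ 1 + ‖x‖ₑ := by
      refine le_trans ?_ le_add_self
      rw [← ofReal_norm]
      refine le_trans ?_ (ENNReal.ofReal_le_ofReal hj)
      rw [ENNReal.ofReal_pow (by norm_num)]
      simp
    rw [pow_succ, mul_comm _ (2⁻¹ : ℝ≥0∞), ← mul_assoc, ENNReal.mul_inv_cancel (by simp) (by simp),
      one_mul, ← ENNReal.inv_pow]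
    exact ENNReal.inv_le_inv.2 hj'

lemma lintegral_mul_weight_le_tsum {F : EuclideanSpace ℝ (Fin n) → ℝ≥0∞} (hF : Measurable F)
    (N : ℕ) (y : EuclideanSpace ℝ (Fin n)) :
    ∫⁻ w, F w * (1 + ‖y - w‖ₑ) ^ (-(N : ℝ)) ≤
      2 ^ N * ∑' l : ℕ, (2⁻¹ : ℝ≥0∞) ^ (l * N) * ∫⁻ w in Metric.ball y (2 ^ l), F w := by
  calc ∫⁻ w, F w * (1 + ‖y - w‖ₑ) ^ (-(N : ℝ))
      ≤ ∫⁻ w, 2 ^ N * ∑' l : ℕ, (2⁻¹ : ℝ≥0∞) ^ (l * N) * (Metric.ball y (2 ^ l)).indicator F w := by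
        refine lintegral_mono fun w => (mul_le_mul' le_rfl (weight_le_tsum N (y - w))).trans_eq ?_
        rw [mul_left_comm, ← ENNReal.tsum_mul_left]
        congr 1
        refine tsum_congr fun l => ?_
        by_cases hw : w ∈ Metric.ball y (2 ^ l)
        · have hw' : y - w ∈ Metric.ball (0 : EuclideanSpace ℝ (Fin n)) (2 ^ l) := by
            rw [mem_ball_zero_iff, ← dist_eq_norm, dist_comm]; exact hw
          simp only [indicator_of_mem hw, indicator_of_mem hw', Pi.one_apply]
          ring
        · have hw' : y - w ∉ Metric.ball (0 : EuclideanSpace ℝ (Fin n)) (2 ^ l) := by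
            rw [mem_ball_zero_iff, ← dist_eq_norm, dist_comm]; exact hw
          simp only [indicator_of_notMem hw, indicator_of_notMem hw']
          ring
    _ = _ := by
        rw [lintegral_const_mul' _ _ (by simp), lintegral_tsum]
        · congr 1
          refine tsum_congr fun l => ?_
          rw [lintegral_const_mul' _ _ (by simp), lintegral_indicator Metric.isOpen_ball.measurableSet]
        · exact fun l => ((hF.indicator Metric.isOpen_ball.measurableSet).const_mul _).aemeasurable

lemma setLIntegral_ball_smul (F : EuclideanSpace ℝ (Fin n) → ℝ≥0∞) (y : EuclideanSpace ℝ (Fin n))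
    {c : ℝ} (hc : 0 < c) (R : ℝ) :
    ∫⁻ w in Metric.ball (c • y) R, F w =
      ENNReal.ofReal c ^ n * ∫⁻ z in Metric.ball y (R / c), F (c • z) := by
  have hpre : (c • ·) ⁻¹' Metric.ball (c • y) R = Metric.ball y (R / c) := by
    ext z
    rw [mem_preimage, Metric.mem_ball, Metric.mem_ball, dist_smul₀, Real.norm_of_nonneg hc.le,
      lt_div_iff₀ hc, mul_comm]
  have hemb : MeasurableEmbedding (fun z : EuclideanSpace ℝ (Fin n) => c • z) :=
    (Homeomorph.smulOfNeZero c hc.ne').measurableEmbedding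
  have h1 : ∫⁻ z in Metric.ball y (R / c), F (c • z) =
      ∫⁻ w in Metric.ball (c • y) R, F w ∂(Measure.map (c • ·) volume) := by
    rw [hemb.restrict_map, hemb.lintegral_map, hpre]
  rw [h1, Measure.map_addHaar_smul _ hc.ne', Measure.restrict_smul, lintegral_smul_measure,
    finrank_euclideanSpace_fin, smul_eq_mul, ← mul_assoc, abs_of_pos (by positivity),
    ← ENNReal.ofReal_pow hc.le, ← ENNReal.ofReal_mul (by positivity),
    mul_inv_cancel₀ (by positivity), ENNReal.ofReal_one, one_mul]

/-- The convolution with `φ` at scale `2 ^ (-k)` is a dilate of the convolution of `φ` at unit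
scale with a dilated distribution. -/
lemma convDist_eq_apply_translate (φ : 𝓢(EuclideanSpace ℝ (Fin n), ℂ))
    (T : 𝓢(EuclideanSpace ℝ (Fin n), ℂ) →L[ℂ] ℂ) (k : ℤ) (x : EuclideanSpace ℝ (Fin n)) :
    convDist n φ T k x = ((((2 : ℝ) ^ (k * (n : ℤ)) : ℝ) : ℂ) •
      T.comp (dilTransCLM 0 ((2 : ℝ) ^ k) (by positivity)))
        (φ.compSubConstCLM ℂ (-((2 : ℝ) ^ k • x))) := by
  rw [convDist, smul_apply, smul_eq_mul, ContinuousLinearMap.comp_apply]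
  congr 2
  ext y
  simp only [dilTransCLM, SchwartzMap.compCLM_apply, Function.comp_apply,
    SchwartzMap.compSubConstCLM_apply]
  congr 1
  abel

/-- The summands of `tlSum`. -/
def tlTerm (n : ℕ) (α q : ℝ) (φ : 𝓢(EuclideanSpace ℝ (Fin n), ℂ))
    (T : 𝓢(EuclideanSpace ℝ (Fin n), ℂ) →L[ℂ] ℂ) (k : ℤ) (x : EuclideanSpace ℝ (Fin n)) : ℝ≥0∞ :=
  (ENNReal.ofReal ((2 : ℝ) ^ (α * (k : ℝ))) * (‖convDist n φ T k x‖₊ : ℝ≥0∞)) ^ q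

lemma measurable_convDist (φ : 𝓢(EuclideanSpace ℝ (Fin n), ℂ))
    (T : 𝓢(EuclideanSpace ℝ (Fin n), ℂ) →L[ℂ] ℂ) (k : ℤ) : Measurable (convDist n φ T k) := by
  simp_rw [funext (convDist_eq_apply_translate φ T k)]
  exact (ContinuousLinearMap.continuous _).comp ((continuous_translate φ).comp
    (by fun_prop)) |>.measurable

lemma measurable_tlTerm (α q : ℝ) (φ : 𝓢(EuclideanSpace ℝ (Fin n), ℂ))
    (T : 𝓢(EuclideanSpace ℝ (Fin n), ℂ) →L[ℂ] ℂ) (k : ℤ) : Measurable (tlTerm n α q φ T k) :=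
  ((measurable_convDist φ T k).enorm.const_mul _).pow_const _

/-- Each summand of `tlSum` is dominated by its averages over balls. -/
lemma exists_tlTerm_le_tsum (α : ℝ) {q : ℝ} (hq : 0 < q) (φ : 𝓢(EuclideanSpace ℝ (Fin n), ℂ))
    {R : ℝ} (hR : 0 < R) (hφ : ∀ ξ, R ≤ ‖ξ‖ → 𝓕 ⇑φ ξ = 0) :
    ∃ C : ℝ≥0∞, C ≠ ⊤ ∧ ∀ (T : 𝓢(EuclideanSpace ℝ (Fin n), ℂ) →L[ℂ] ℂ) (k : ℤ) y,
      tlTerm n α q φ T k y ≤ C * ∑' l : ℕ, (2⁻¹ : ℝ≥0∞) ^ (l * (2 * n + 1)) *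
        (ENNReal.ofReal ((2 : ℝ) ^ k) ^ n *
          ∫⁻ z in Metric.ball y ((2 : ℝ) ^ l / (2 : ℝ) ^ k), tlTerm n α q φ T k z) := by
  obtain ⟨C, hC, h⟩ := exists_enorm_apply_translate_rpow_le (s := ((2 * n + 1 : ℕ) : ℝ)) hq
    (by push_cast; linarith [(Nat.cast_nonneg n : (0 : ℝ) ≤ n)]) φ hR hφ
  refine ⟨C * 2 ^ (2 * n + 1), by finiteness, fun T k y => ?_⟩
  set S := (((2 : ℝ) ^ (k * (n : ℤ)) : ℝ) : ℂ) •
      T.comp (dilTransCLM 0 ((2 : ℝ) ^ k) (by positivity)) with hS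
  set F : EuclideanSpace ℝ (Fin n) → ℝ≥0∞ := fun w => ‖S (φ.compSubConstCLM ℂ (-w))‖ₑ ^ q with hF
  have hFm : Measurable F :=
    (S.continuous.comp ((continuous_translate φ).comp continuous_neg)).enorm.measurable.pow_const q
  set A := ENNReal.ofReal ((2 : ℝ) ^ (α * (k : ℝ))) ^ q with hA
  have hAtop : A ≠ ⊤ := ENNReal.rpow_ne_top_of_nonneg hq.le (by simp)
  have hterm (z : EuclideanSpace ℝ (Fin n)) :
      tlTerm n α q φ T k z = A * F ((2 : ℝ) ^ k • z) := by
    rw [tlTerm, convDist_eq_apply_translate, ENNReal.mul_rpow_of_nonneg _ _ hq.le]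
    rfl
  calc tlTerm n α q φ T k y = A * F ((2 : ℝ) ^ k • y) := hterm y
    _ ≤ A * (C * (2 ^ (2 * n + 1) * ∑' l : ℕ, (2⁻¹ : ℝ≥0∞) ^ (l * (2 * n + 1)) *
          ∫⁻ w in Metric.ball ((2 : ℝ) ^ k • y) (2 ^ l), F w)) :=
        mul_le_mul' le_rfl ((h S _).trans
          (mul_le_mul' le_rfl (lintegral_mul_weight_le_tsum hFm _ _)))
    _ = C * 2 ^ (2 * n + 1) * ∑' l : ℕ, (2⁻¹ : ℝ≥0∞) ^ (l * (2 * n + 1)) *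
          (A * ∫⁻ w in Metric.ball ((2 : ℝ) ^ k • y) (2 ^ l), F w) := by
        simp_rw [mul_left_comm _ A, ENNReal.tsum_mul_left]
        ring
    _ = _ := by
        congr 1
        refine tsum_congr fun l => ?_
        rw [setLIntegral_ball_smul F y (by positivity)]
        simp_rw [hterm]
        rw [lintegral_const_mul' _ _ hAtop]
        ring

end Scaling

lemma tsum_tlTerm_le_tlSum (n : ℕ) (α q : ℝ) (φ : 𝓢(EuclideanSpace ℝ (Fin n), ℂ))
    (T : 𝓢(EuclideanSpace ℝ (Fin n), ℂ) →L[ℂ] ℂ) {k₀ : ℤ} {h : ℝ} (hh : ((2 : ℝ) ^ k₀)⁻¹ ≤ h)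
    (x : EuclideanSpace ℝ (Fin n)) :
    ∑' i : ℕ, tlTerm n α q φ T (k₀ + i) x ≤ tlSum n α q φ T h x := by
  have hk (i : ℕ) : (2 : ℝ) ^ (-(k₀ + i)) ≤ h := by
    refine le_trans ?_ hh
    rw [← zpow_neg]
    exact zpow_le_zpow_right₀ (by norm_num) (by omega)
  refine ENNReal.tsum_comp_le_tsum_of_injective (f := fun i : ℕ =>
    (⟨k₀ + i, hk i⟩ : {k : ℤ // (2 : ℝ) ^ (-k) ≤ h})) (fun i j hij => ?_)
    fun k => tlTerm n α q φ T k.1 x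
  simpa using hij

lemma exists_tlSum_eq_tsum {h : ℝ} (hh : 0 < h) :
    ∃ k₀ : ℤ, ((2 : ℝ) ^ k₀)⁻¹ ≤ h ∧ ∀ (n : ℕ) (α q : ℝ) (φ : 𝓢(EuclideanSpace ℝ (Fin n), ℂ))
      (T : 𝓢(EuclideanSpace ℝ (Fin n), ℂ) →L[ℂ] ℂ) (x : EuclideanSpace ℝ (Fin n)),
      tlSum n α q φ T h x = ∑' i : ℕ, tlTerm n α q φ T (k₀ + i) x := by
  obtain ⟨m, hm1, hm2⟩ := exists_mem_Ico_zpow hh _root_.one_lt_two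
  have hk₀ : ((2 : ℝ) ^ (-m))⁻¹ ≤ h := by rwa [zpow_neg, inv_inv]
  refine ⟨-m, hk₀, fun n α q φ T x => le_antisymm ?_ (tsum_tlTerm_le_tlSum n α q φ T hk₀ x)⟩
  have hmem (k : {k : ℤ // (2 : ℝ) ^ (-k) ≤ h}) : -m ≤ k.1 := by
    have := (zpow_lt_zpow_iff_right₀ _root_.one_lt_two).1 (k.2.trans_lt hm2)
    omega
  have hinj : Function.Injective fun k : {k : ℤ // (2 : ℝ) ^ (-k) ≤ h} => (k.1 - -m).toNat := by
    intro k l hkl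
    have := hmem k
    have := hmem l
    ext
    simp only at hkl
    omega
  refine le_trans (le_of_eq ?_) (ENNReal.tsum_comp_le_tsum_of_injective hinj
    fun i : ℕ => tlTerm n α q φ T (-m + i) x)
  refine tsum_congr fun k => ?_
  have : -m + ((k.1 - -m).toNat : ℤ) = k.1 := by
    have := hmem k
    omega
  rw [this]
  rfl

/-- Jensen's inequality for averages of powers. -/
lemma setLIntegral_rpow_div_le {X : Type*} [MeasurableSpace X] {μ : Measure X} {s : Set X}
    (hs0 : μ s ≠ 0) (hs : μ s ≠ ⊤) {g : X → ℝ≥0∞} (hg : Measurable g) {p r : ℝ} (hp : 0 < p)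
    (hpr : p ≤ r) :
    (∫⁻ x in s, g x ^ p ∂μ) / μ s ≤ ((∫⁻ x in s, g x ^ r ∂μ) / μ s) ^ (p / r) := by
  have hr : 0 < r := hp.trans_le hpr
  have hprob : IsProbabilityMeasure ((μ s)⁻¹ • μ.restrict s) :=
    ⟨by simp [ENNReal.inv_mul_cancel hs0 hs]⟩
  have hav (t : ℝ) : (∫⁻ x in s, g x ^ t ∂μ) / μ s =
      ∫⁻ x, g x ^ t ∂((μ s)⁻¹ • μ.restrict s) := by
    rw [lintegral_smul_measure, smul_eq_mul, div_eq_mul_inv, mul_comm]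
  have h := eLpNorm'_le_eLpNorm'_of_exponent_le hp hpr ((μ s)⁻¹ • μ.restrict s)
    hg.aestronglyMeasurable
  simp only [eLpNorm', enorm_eq_self] at h
  rw [hav, hav]
  calc _ = ((∫⁻ x, g x ^ p ∂((μ s)⁻¹ • μ.restrict s)) ^ (1 / p)) ^ p := by
        rw [← ENNReal.rpow_mul, one_div_mul_cancel hp.ne', ENNReal.rpow_one]
    _ ≤ _ := ENNReal.rpow_le_rpow h hp.le
    _ = _ := by rw [← ENNReal.rpow_mul, one_div_mul_eq_div]

end JNW

/-- **Lemma 5.11.** Let `α ∈ ℝ` and `0 < p, q < ∞`.  There is a constant `C` (depending on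
`α, p, q, n, φ`) such that for all tempered distributions `f` (the quantities below only
depend on the class of `f` in `𝒮'/𝒫`, since `φ̂` vanishes near the origin),
`sup_{Q∈𝒬} (1/|Q|) ∫_Q (Σ_{k : 2^{-k} ≤ ℓ(Q)} (2^{αk}|φ_k*f(x)|)^q)^p dx ≤ C ‖f‖_{Ḟ_∞^{α,q}}^{pq}`. -/
theorem statement18
    (n : ℕ) (α p q : ℝ) (hp : 0 < p) (hq : 0 < q)
    (φ : 𝓢(EuclideanSpace ℝ (Fin n), ℂ)) (c₀ : ℝ) (hc₀ : 0 < c₀)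
    (hsupp : ∀ ξ : EuclideanSpace ℝ (Fin n), ‖ξ‖ ≤ 1/2 ∨ 2 ≤ ‖ξ‖ → 𝓕 ⇑φ ξ = 0)
    (hlow : ∀ ξ : EuclideanSpace ℝ (Fin n), 3/5 < ‖ξ‖ → ‖ξ‖ < 5/3 →
      (𝓕 ⇑φ ξ).im = 0 ∧ c₀ ≤ (𝓕 ⇑φ ξ).re) :
    ∃ C : ℝ≥0∞, C < ⊤ ∧
      ∀ T : 𝓢(EuclideanSpace ℝ (Fin n), ℂ) →L[ℂ] ℂ,
        (⨆ (a : EuclideanSpace ℝ (Fin n)) (h : ℝ) (_ : 0 < h),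
          (∫⁻ x in JNW.ecube a h, JNW.tlSum n α q φ T h x ^ p) / volume (JNW.ecube a h)) ≤
        C * JNW.tlNorm n α q φ T ^ (p * q) := by
  obtain ⟨C₀, hC₀, hC⟩ := JNW.exists_tlTerm_le_tsum α hq φ two_pos fun ξ hξ => hsupp ξ (Or.inr hξ)
  set m : ℕ := ⌈p⌉₊
  have hpm : p ≤ m := Nat.le_ceil p
  have hm : (0 : ℝ) < m := hp.trans_le hpm
  set D : ℝ≥0∞ := m.factorial * (2 * 6 ^ n * (C₀ + 1)) ^ m with hD
  have hD0 : D ≠ 0 := by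
    simp [hD, Nat.factorial_ne_zero]
  have hDtop : D ≠ ⊤ := by finiteness
  refine ⟨D ^ (p / m), (ENNReal.rpow_ne_top_of_nonneg (by positivity) hDtop).lt_top, fun T => ?_⟩
  set B : ℝ≥0∞ := ⨆ (a : EuclideanSpace ℝ (Fin n)) (h : ℝ) (_ : 0 < h),
    (∫⁻ x in JNW.ecube a h, JNW.tlSum n α q φ T h x) / volume (JNW.ecube a h) with hB
  have hnorm : JNW.tlNorm n α q φ T ^ (p * q) = B ^ p := by
    rw [JNW.tlNorm, ← hB, ← ENNReal.rpow_mul]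
    congr 1
    field_simp
  rw [hnorm]
  refine iSup_le fun a => iSup_le fun h => iSup_le fun hh => ?_
  have hvol (b : EuclideanSpace ℝ (Fin n)) {s : ℝ} (hs : 0 < s) :
      volume (JNW.ecube b s) ≠ 0 ∧ volume (JNW.ecube b s) ≠ ⊤ := by
    rw [JNW.volume_ecube]
    exact ⟨pow_ne_zero _ (by simpa using hs), by finiteness⟩
  have hf := JNW.measurable_tlTerm α q φ T
  obtain ⟨k₀, hk₀, hsum⟩ := JNW.exists_tlSum_eq_tsum hh
  simp_rw [hsum]
  calc _ ≤ ((∫⁻ x in JNW.ecube a h, (∑' i : ℕ, JNW.tlTerm n α q φ T (k₀ + i) x) ^ (m : ℝ)) /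
        volume (JNW.ecube a h)) ^ (p / m) :=
        JNW.setLIntegral_rpow_div_le (hvol a hh).1 (hvol a hh).2
          (Measurable.tsum fun i => hf _) hp hpm
    _ ≤ (D * B ^ m) ^ (p / m) := by
        refine ENNReal.rpow_le_rpow ?_ (by positivity)
        rw [ENNReal.div_le_iff (hvol a hh).1 (hvol a hh).2, JNW.volume_ecube]
        simp_rw [ENNReal.rpow_natCast]
        refine JNW.lintegral_tail_pow_le hf (fun k y => (hC T k y).trans ?_) ?_ m k₀ a h hk₀
        · exact mul_le_mul' le_self_add le_rfl
        · intro k₁ b s hs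
          have hs0 : 0 < s := (by positivity : (0 : ℝ) < ((2 : ℝ) ^ k₁)⁻¹).trans_le hs
          rw [← JNW.volume_ecube b, ← ENNReal.div_le_iff (hvol b hs0).1 (hvol b hs0).2]
          refine le_trans ?_ (le_iSup₂_of_le b s (le_iSup_of_le hs0 le_rfl))
          gcongr with x
          exact JNW.tsum_tlTerm_le_tlSum n α q φ T hs x
    _ = D ^ (p / m) * B ^ p := by
        rw [ENNReal.mul_rpow_of_nonneg _ _ (by positivity), ← ENNReal.rpow_natCast,
          ← ENNReal.rpow_mul, mul_div_cancel₀ _ hm.ne']
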